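/- arXiv:2505.21737 — 3 statements merged into one kernel-verified Lean document; each statement's English description precedes it below -/
import Mathlib

section
/- Let α, β be integers with α < β, let c ∈ (0,1), and let g : [α,β] → ℝ be a decreasing concave function which is c-Lipschitz on [α,β]. Assume additionally that ⌊g(α)⌋ = ⌊g(p)⌋ > ⌊g(p+1)⌋ for some integer p ∈ [α,β). Then T(g,α,β) ≤ ∫_α^β g(z) dz − (1−c)(β−p)/2. -/
open Real Set

/-- The trapezoidal floor sum of `g` on `[a,b]`. -/
noncomputable def trapSum (g : ℝ → ℝ) (a b : ℤ) : ℝ :=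
  (⌊g a⌋ : ℝ) / 2 + ∑ m ∈ Finset.Ioo a b, (⌊g m⌋ : ℝ) + (⌊g b⌋ : ℝ) / 2

/-- `g` is `c`-Lipschitz on the set `s`. -/
def LipschitzWithConstOn (c : ℝ) (g : ℝ → ℝ) (s : Set ℝ) : Prop :=
  ∀ z ∈ s, ∀ w ∈ s, |g z - g w| ≤ c * |z - w|

theorem trapSum_add_one_self (g : ℝ → ℝ) (a : ℤ) :
    trapSum g a (a + 1) = ((⌊g a⌋ : ℝ) + ⌊g (a + 1 : ℤ)⌋) / 2 := by
  have h : Finset.Ioo a (a + 1) = ∅ := by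
    ext x
    simp
  rw [trapSum, h, Finset.sum_empty]
  ring

theorem trapSum_add_one {a n : ℤ} (g : ℝ → ℝ) (h : a < n) :
    trapSum g a (n + 1) = trapSum g a n + ((⌊g n⌋ : ℝ) + ⌊g (n + 1 : ℤ)⌋) / 2 := by
  have h : Finset.Ioo a (n + 1) = insert n (Finset.Ioo a n) := by
    ext x
    simp
    omega
  rw [trapSum, trapSum, h, Finset.sum_insert (by simp)]
  ring

theorem trapSum_eq_of_floor_eq {a b : ℤ} {g : ℝ → ℝ} (hab : a < b)
    (hg : AntitoneOn g (Icc (a : ℝ) b)) (h : ⌊g a⌋ = ⌊g b⌋) :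
    trapSum g a b = (b - a) * ⌊g b⌋ := by
  have hab' : (a : ℝ) ≤ b := by exact_mod_cast hab.le
  have hsum : ∑ m ∈ Finset.Ioo a b, (⌊g m⌋ : ℝ) = ∑ m ∈ Finset.Ioo a b, (⌊g b⌋ : ℝ) := by
    refine Finset.sum_congr rfl fun m hm ↦ ?_
    rw [Finset.mem_Ioo] at hm
    have h1 : (a : ℝ) ≤ m := by exact_mod_cast hm.1.le
    have h2 : (m : ℝ) ≤ b := by exact_mod_cast hm.2.le
    have h3 := Int.floor_mono (hg ⟨le_rfl, hab'⟩ ⟨h1, h2⟩ h1)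
    have h4 := Int.floor_mono (hg ⟨h1, h2⟩ ⟨hab', le_rfl⟩ h2)
    exact_mod_cast le_antisymm (h ▸ h3) h4
  have hcard : ((b - a - 1).toNat : ℝ) = b - a - 1 := by
    have : ((b - a - 1).toNat : ℤ) = b - a - 1 := Int.toNat_of_nonneg (by omega)
    exact_mod_cast this
  rw [trapSum, hsum, Finset.sum_const, Int.card_Ioo, nsmul_eq_mul, hcard, h]
  ring

theorem ConcaveOn.trapezoid_le_integral {g : ℝ → ℝ} {a b : ℝ} (hab : a ≤ b)
    (hg : ConcaveOn ℝ (Icc a b) g) (hint : IntervalIntegrable g MeasureTheory.volume a b) :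
    (b - a) * ((g a + g b) / 2) ≤ ∫ z in a..b, g z := by
  rcases hab.eq_or_lt with rfl | hlt
  · simp
  have hpos : 0 < b - a := sub_pos.2 hlt
  have hchord : ∫ z in a..b, (g a + (g b - g a) / (b - a) * (z - a))
      = (b - a) * ((g a + g b) / 2) := by
    rw [intervalIntegral.integral_add (by simp) (Continuous.intervalIntegrable (by fun_prop) _ _),
      intervalIntegral.integral_const_mul,
      intervalIntegral.integral_sub (by simp) (by simp)]
    simp only [intervalIntegral.integral_const, integral_id, smul_eq_mul]
    field_simp
    ring
  rw [← hchord]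
  refine intervalIntegral.integral_mono_on hab
    (Continuous.intervalIntegrable (by fun_prop) _ _) hint fun x hx ↦ ?_
  have h := hg.2 (left_mem_Icc.2 hab) (right_mem_Icc.2 hab)
    (div_nonneg (sub_nonneg.2 hx.2) hpos.le) (div_nonneg (sub_nonneg.2 hx.1) hpos.le)
    (by field_simp; ring)
  have hx' : (b - x) / (b - a) * a + (x - a) / (b - a) * b = x := by
    field_simp
    ring
  simp only [smul_eq_mul, hx'] at h
  refine le_trans (le_of_eq ?_) h
  field_simp
  ring

theorem trapSum_le_of_concave_lipschitz_middle (α β : ℤ) (hab : α < β) (c : ℝ)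
    (hc0 : 0 < c) (hc1 : c < 1) (g : ℝ → ℝ)
    (hdec : AntitoneOn g (Set.Icc (α : ℝ) β))
    (hconc : ConcaveOn ℝ (Set.Icc (α : ℝ) β) g)
    (hlip : LipschitzWithConstOn c g (Set.Icc (α : ℝ) β))
    (p : ℤ) (hp1 : α ≤ p) (hp2 : p < β)
    (hfloor1 : ⌊g α⌋ = ⌊g p⌋) (hfloor2 : ⌊g (p + 1 : ℤ)⌋ < ⌊g p⌋) :
    trapSum g α β ≤ (∫ z in (α : ℝ)..β, g z) - (1 - c) * (β - p) / 2 := by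
  have hsub {a b : ℤ} (ha : α ≤ a) (hb : b ≤ β) : Icc (a : ℝ) b ⊆ Icc (α : ℝ) β :=
    Icc_subset_Icc (by exact_mod_cast ha) (by exact_mod_cast hb)
  have hint {a b : ℤ} (ha : α ≤ a) (h : a ≤ b) (hb : b ≤ β) :
      IntervalIntegrable g MeasureTheory.volume a b := by
    apply AntitoneOn.intervalIntegrable
    rw [uIcc_of_le (by exact_mod_cast h)]
    exact hdec.mono (hsub ha hb)
  have htrap {a b : ℤ} (ha : α ≤ a) (h : a ≤ b) (hb : b ≤ β) :
      (∫ z in (α : ℝ)..a, g z) + (b - a) * ((g a + g b) / 2) ≤ ∫ z in (α : ℝ)..b, g z := by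
    rw [← intervalIntegral.integral_add_adjacent_intervals
      (hint le_rfl ha (h.trans hb)) (hint ha h hb)]
    gcongr
    exact (hconc.subset (hsub ha hb) (convex_Icc _ _)).trapezoid_le_integral
      (by exact_mod_cast h) (hint ha h hb)
  have hcross {n : ℤ} (h1 : α ≤ n) (h2 : n + 1 ≤ β) (h : ⌊g (n + 1 : ℤ)⌋ < ⌊g n⌋) :
      (⌊g (n + 1 : ℤ)⌋ : ℝ) + (1 - c) ≤ g (n + 1 : ℤ) := by
    have h3 : (⌊g (n + 1 : ℤ)⌋ : ℝ) + 1 ≤ ⌊g n⌋ := by exact_mod_cast h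
    have h1' : (α : ℝ) ≤ n := by exact_mod_cast h1
    have h2' : (n : ℝ) + 1 ≤ β := by exact_mod_cast h2
    have h4 := (le_abs_self _).trans (hlip n ⟨h1', by linarith⟩ (n + 1 : ℤ)
      ⟨by push_cast; linarith, by push_cast; linarith⟩)
    have h5 : |(n : ℝ) - (n + 1 : ℤ)| = 1 := by
      push_cast
      simp
    rw [h5] at h4
    linarith [Int.floor_le (g n)]
  have hrun {s n : ℤ} (hs1 : p + 1 ≤ s) (hs2 : s ≤ n) (hn : n ≤ β) (hfl : ⌊g n⌋ = ⌊g s⌋)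
      (hfr : (⌊g s⌋ : ℝ) + (1 - c) ≤ g s)
      (hle : trapSum g α n ≤
        (∫ z in (α : ℝ)..s, g z) - (1 - c) * (s - p) / 2 + (n - s) * ⌊g s⌋) :
      trapSum g α n ≤ (∫ z in (α : ℝ)..n, g z) - (1 - c) * (n - p) / 2 := by
    have h1 := htrap (by omega : α ≤ s) hs2 hn
    have h2 : (⌊g s⌋ : ℝ) ≤ g n := hfl ▸ Int.floor_le _
    have h3 : (0 : ℝ) ≤ n - s := sub_nonneg.2 (by exact_mod_cast hs2)
    linarith [mul_le_mul_of_nonneg_left (add_le_add hfr h2) h3]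
  -- `s` is the first integer of the maximal run up to `n` on which `⌊g ·⌋` is constant.
  have key (n : ℤ) (hn : p + 1 ≤ n) : n ≤ β → ∃ s : ℤ, p + 1 ≤ s ∧ s ≤ n ∧ ⌊g n⌋ = ⌊g s⌋ ∧
      (⌊g s⌋ : ℝ) + (1 - c) ≤ g s ∧
      trapSum g α n ≤ (∫ z in (α : ℝ)..s, g z) - (1 - c) * (s - p) / 2 + (n - s) * ⌊g s⌋ := by
    induction n, hn using Int.leInduction with
    | base =>
      intro hn
      have hfr := hcross hp1 hn hfloor2
      refine ⟨p + 1, le_rfl, le_rfl, rfl, hfr, ?_⟩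
      have h1 := htrap hp1 (by omega : p ≤ p + 1) hn
      have h2 := Int.floor_le (g p)
      rcases hp1.eq_or_lt with rfl | hlt
      · rw [trapSum_add_one_self]
        push_cast at *
        simp only [intervalIntegral.integral_same] at h1
        linarith
      · have h3 := trapSum_eq_of_floor_eq hlt (hdec.mono (hsub le_rfl hp2.le)) hfloor1
        have h4 := htrap le_rfl hp1 hp2.le
        have h5 : (⌊g p⌋ : ℝ) ≤ g α := hfloor1 ▸ Int.floor_le _
        have h6 : (0 : ℝ) ≤ p - α := sub_nonneg.2 (by exact_mod_cast hp1)
        rw [trapSum_add_one g hlt, h3]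
        push_cast at *
        simp only [intervalIntegral.integral_same] at h4
        linarith [mul_le_mul_of_nonneg_left (add_le_add h5 h2) h6]
    | succ n hpn ih =>
      intro hn
      obtain ⟨s, hs1, hs2, hfl, hfr, hle⟩ := ih (by omega)
      have hαn : α < n := by omega
      have hle_n : (n : ℝ) ≤ (n + 1 : ℤ) := by exact_mod_cast (by omega : n ≤ n + 1)
      have hanti : g (n + 1 : ℤ) ≤ g n :=
        hdec.mono (hsub hαn.le hn) ⟨le_rfl, hle_n⟩ ⟨hle_n, le_rfl⟩ hle_n
      rcases (Int.floor_mono hanti).eq_or_lt with heq | hlt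
      · refine ⟨s, hs1, by omega, heq.trans hfl, hfr, ?_⟩
        rw [trapSum_add_one g hαn, heq, hfl]
        push_cast
        linarith
      · have hfr' := hcross hαn.le hn hlt
        refine ⟨n + 1, by omega, le_rfl, rfl, hfr', ?_⟩
        have h1 := hrun hs1 hs2 (by omega) hfl hfr hle
        have h2 := htrap hαn.le (by omega : n ≤ n + 1) hn
        have h3 := Int.floor_le (g n)
        rw [trapSum_add_one g hαn]
        push_cast at *
        linarith
  obtain ⟨s, hs1, hs2, hfl, hfr, hle⟩ := key β hp2 le_rfl
  exact hrun hs1 hs2 le_rfl hfl hfr hle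
end

section
/- Let λ > μ > 0. Then the function Φ_{λ,μ} is decreasing and concave on [0, μ], and is c_{λ,μ}-Lipschitz on [0, μ], where c_{λ,μ} = (1/π)·arccos(μ/λ) satisfies c_{λ,μ} < (1/2)√(1 − μ/λ) < 1/2. Moreover, for every z ∈ (0,μ) the first, second and third derivatives of Φ_{λ,μ} at z are all negative: Φ'_{λ,μ}(z) = (1/π)(arcsin(z/λ) − arcsin(z/μ)) < 0, Φ''_{λ,μ}(z) = (1/π)(1/√(λ²−z²) − 1/√(μ²−z²)) < 0, and Φ'''_{λ,μ}(z) = (z/π)((λ²−z²)^{−3/2} − (μ²−z²)^{−3/2}) < 0. -/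
open Real Set

/-- The function `G_λ(z) = (1/π)(√(λ² − z²) − z·arccos(z/λ))` for `z ≤ λ`, and `0` for `z > λ`. -/
noncomputable def funG (lam z : ℝ) : ℝ :=
  if z ≤ lam then (Real.sqrt (lam ^ 2 - z ^ 2) - z * Real.arccos (z / lam)) / π else 0

/-- The function `Φ_{λ,μ}(z) = G_λ(z) − G_μ(z)`. -/
noncomputable def funPhi (lam mu z : ℝ) : ℝ := funG lam z - funG mu z

theorem hasDerivAt_arcsin_div {a z : ℝ} (hz : z ∈ Ioo (-a) a) :
    HasDerivAt (fun x => Real.arcsin (x / a)) (1 / Real.sqrt (a ^ 2 - z ^ 2)) z := by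
  obtain ⟨h1, h2⟩ := hz
  have ha : 0 < a := by linarith
  have hlt : z / a < 1 := (div_lt_one ha).2 h2
  have hgt : -1 < z / a := by rw [lt_div_iff₀ ha]; linarith
  have h := (Real.hasDerivAt_arcsin hgt.ne' hlt.ne).comp z ((hasDerivAt_id z).div_const a)
  refine h.congr_deriv ?_
  have e : a ^ 2 - z ^ 2 = a ^ 2 * (1 - (z / a) ^ 2) := by field_simp
  rw [e, Real.sqrt_mul (sq_nonneg a), Real.sqrt_sq ha.le]
  simp [div_eq_mul_inv, mul_comm]

theorem hasDerivAt_one_div_sqrt_sq_sub_sq {a z : ℝ} (hz : z ∈ Ioo (-a) a) :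
    HasDerivAt (fun x => 1 / Real.sqrt (a ^ 2 - x ^ 2))
      (z * (a ^ 2 - z ^ 2) ^ (-(3 : ℝ) / 2)) z := by
  have hpos : 0 < a ^ 2 - z ^ 2 := by nlinarith [hz.1, hz.2]
  have h := ((hasDerivAt_pow 2 z).const_sub (a ^ 2)).rpow_const (p := -(1 / 2)) (Or.inl hpos.ne')
  have hev : (fun x => 1 / Real.sqrt (a ^ 2 - x ^ 2)) =ᶠ[nhds z]
      fun x => (a ^ 2 - x ^ 2) ^ (-(1 / 2) : ℝ) := by
    filter_upwards [isOpen_Ioo.mem_nhds hz] with x hx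
    have hx' : 0 ≤ a ^ 2 - x ^ 2 := by nlinarith [hx.1, hx.2]
    rw [Real.rpow_neg hx', ← Real.sqrt_eq_rpow, one_div]
  refine (h.congr_of_eventuallyEq hev).congr_deriv ?_
  rw [show (-(1 / 2) - 1 : ℝ) = -3 / 2 by norm_num]
  push_cast
  ring

theorem hasDerivAt_funG {a z : ℝ} (hz : z ∈ Ioo (-a) a) :
    HasDerivAt (funG a) (-(1 / π) * Real.arccos (z / a)) z := by
  have hpos : 0 < a ^ 2 - z ^ 2 := by nlinarith [hz.1, hz.2]
  have hev : funG a =ᶠ[nhds z]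
      fun x => (Real.sqrt (a ^ 2 - x ^ 2) - x * (π / 2 - Real.arcsin (x / a))) / π := by
    filter_upwards [isOpen_Ioo.mem_nhds hz] with x hx
    rw [funG, if_pos hx.2.le, Real.arccos]
  have h := ((((hasDerivAt_pow 2 z).const_sub (a ^ 2)).sqrt hpos.ne').sub
    ((hasDerivAt_id z).mul ((hasDerivAt_arcsin_div hz).const_sub (π / 2)))).div_const π
  refine (h.congr_of_eventuallyEq hev).congr_deriv ?_
  have hs := Real.sqrt_pos.2 hpos
  rw [Real.arccos]
  simp only [id]
  field_simp
  push_cast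
  ring

theorem continuousOn_funG (a : ℝ) : ContinuousOn (funG a) (Iic a) := by
  have h : Continuous fun x =>
      (Real.sqrt (a ^ 2 - x ^ 2) - x * Real.arccos (x / a)) / π := by fun_prop
  exact h.continuousOn.congr fun x hx => if_pos hx

theorem continuousOn_funPhi {lam mu : ℝ} (hml : mu < lam) :
    ContinuousOn (funPhi lam mu) (Icc 0 mu) :=
  ((continuousOn_funG lam).mono fun _ hx => hx.2.trans hml.le).sub
    ((continuousOn_funG mu).mono fun _ hx => hx.2)

theorem hasDerivAt_funPhi {lam mu z : ℝ} (hml : mu < lam) (hz : z ∈ Ioo (-mu) mu) :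
    HasDerivAt (funPhi lam mu)
      ((1 / π) * (Real.arcsin (z / lam) - Real.arcsin (z / mu))) z := by
  have hz' : z ∈ Ioo (-lam) lam := ⟨by linarith [hz.1], hz.2.trans hml⟩
  refine ((hasDerivAt_funG hz').sub (hasDerivAt_funG hz)).congr_deriv ?_
  rw [Real.arccos, Real.arccos]
  ring

theorem deriv_funPhi_eventuallyEq {lam mu z : ℝ} (hml : mu < lam) (hz : z ∈ Ioo (-mu) mu) :
    deriv (funPhi lam mu) =ᶠ[nhds z]
      fun x => (1 / π) * (Real.arcsin (x / lam) - Real.arcsin (x / mu)) := by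
  filter_upwards [isOpen_Ioo.mem_nhds hz] with x hx
  exact (hasDerivAt_funPhi hml hx).deriv

theorem hasDerivAt_deriv_funPhi {lam mu z : ℝ} (hml : mu < lam) (hz : z ∈ Ioo (-mu) mu) :
    HasDerivAt (deriv (funPhi lam mu))
      ((1 / π) * (1 / Real.sqrt (lam ^ 2 - z ^ 2) - 1 / Real.sqrt (mu ^ 2 - z ^ 2))) z := by
  have hz' : z ∈ Ioo (-lam) lam := ⟨by linarith [hz.1], hz.2.trans hml⟩
  exact (((hasDerivAt_arcsin_div hz').sub (hasDerivAt_arcsin_div hz)).const_mul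
    (1 / π)).congr_of_eventuallyEq (deriv_funPhi_eventuallyEq hml hz)

theorem hasDerivAt_deriv_deriv_funPhi {lam mu z : ℝ} (hml : mu < lam)
    (hz : z ∈ Ioo (-mu) mu) :
    HasDerivAt (deriv (deriv (funPhi lam mu)))
      ((z / π) * ((lam ^ 2 - z ^ 2) ^ (-(3 : ℝ) / 2) - (mu ^ 2 - z ^ 2) ^ (-(3 : ℝ) / 2))) z := by
  have hz' : z ∈ Ioo (-lam) lam := ⟨by linarith [hz.1], hz.2.trans hml⟩
  have hev : deriv (deriv (funPhi lam mu)) =ᶠ[nhds z] fun x =>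
      (1 / π) * (1 / Real.sqrt (lam ^ 2 - x ^ 2) - 1 / Real.sqrt (mu ^ 2 - x ^ 2)) := by
    filter_upwards [isOpen_Ioo.mem_nhds hz] with x hx
    exact (hasDerivAt_deriv_funPhi hml hx).deriv
  refine ((((hasDerivAt_one_div_sqrt_sq_sub_sq hz').sub
    (hasDerivAt_one_div_sqrt_sq_sub_sq hz)).const_mul
    (1 / π)).congr_of_eventuallyEq hev).congr_deriv ?_
  ring

theorem arcsin_div_sub_arcsin_div_neg {lam mu z : ℝ} (hml : mu < lam) (hz : z ∈ Ioo 0 mu) :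
    (1 / π) * (Real.arcsin (z / lam) - Real.arcsin (z / mu)) < 0 := by
  have hmu : 0 < mu := hz.1.trans hz.2
  have hlt : z / lam < z / mu := div_lt_div_of_pos_left hz.1 hmu hml
  have hpos : 0 < z / lam := div_pos hz.1 (hmu.trans hml)
  have h := Real.arcsin_lt_arcsin (by linarith) hlt ((div_le_one hmu).2 hz.2.le)
  exact mul_neg_of_pos_of_neg (by positivity) (by linarith)

theorem one_div_sqrt_sub_one_div_sqrt_neg {lam mu z : ℝ} (hml : mu < lam)
    (hz : z ∈ Ioo (-mu) mu) :
    (1 / π) * (1 / Real.sqrt (lam ^ 2 - z ^ 2) - 1 / Real.sqrt (mu ^ 2 - z ^ 2)) < 0 := by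
  have hpos : 0 < mu ^ 2 - z ^ 2 := by nlinarith [hz.1, hz.2]
  have hlt : mu ^ 2 - z ^ 2 < lam ^ 2 - z ^ 2 := by nlinarith [hz.1, hz.2]
  have h := one_div_lt_one_div_of_lt (Real.sqrt_pos.2 hpos) (Real.sqrt_lt_sqrt hpos.le hlt)
  exact mul_neg_of_pos_of_neg (by positivity) (by linarith)

theorem rpow_sub_rpow_neg {lam mu z : ℝ} (hml : mu < lam) (hz : z ∈ Ioo 0 mu) :
    (z / π) * ((lam ^ 2 - z ^ 2) ^ (-(3 : ℝ) / 2) - (mu ^ 2 - z ^ 2) ^ (-(3 : ℝ) / 2)) < 0 := by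
  have hpos : 0 < mu ^ 2 - z ^ 2 := by nlinarith [hz.1, hz.2]
  have hlt : mu ^ 2 - z ^ 2 < lam ^ 2 - z ^ 2 := by nlinarith [hz.1, hz.2]
  have h := Real.rpow_lt_rpow_of_neg hpos hlt (show (-(3 : ℝ) / 2) < 0 by norm_num)
  exact mul_neg_of_pos_of_neg (div_pos hz.1 Real.pi_pos) (by linarith)

theorem Ioo_zero_subset_Ioo_neg (mu : ℝ) : Ioo 0 mu ⊆ Ioo (-mu) mu :=
  fun _ hz => ⟨by linarith [hz.1, hz.2], hz.2⟩

theorem antitoneOn_arcsin_div_sub_arcsin_div {lam mu : ℝ} (hml : mu < lam) :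
    AntitoneOn (fun x => (1 / π) * (Real.arcsin (x / lam) - Real.arcsin (x / mu)))
      (Icc 0 mu) := by
  refine antitoneOn_of_hasDerivWithinAt_nonpos (convex_Icc 0 mu)
    (f' := fun z => (1 / π) * (1 / Real.sqrt (lam ^ 2 - z ^ 2) - 1 / Real.sqrt (mu ^ 2 - z ^ 2)))
    (by fun_prop) ?_ ?_ <;> rw [interior_Icc] <;> intro z hz <;>
    have hz := Ioo_zero_subset_Ioo_neg mu hz
  · exact ((hasDerivAt_deriv_funPhi hml hz).congr_of_eventuallyEq
      (deriv_funPhi_eventuallyEq hml hz).symm).hasDerivWithinAt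
  · exact (one_div_sqrt_sub_one_div_sqrt_neg hml hz).le

theorem antitoneOn_funPhi {lam mu : ℝ} (hml : mu < lam) :
    AntitoneOn (funPhi lam mu) (Icc 0 mu) := by
  refine antitoneOn_of_hasDerivWithinAt_nonpos (convex_Icc 0 mu)
    (f' := fun z => (1 / π) * (Real.arcsin (z / lam) - Real.arcsin (z / mu)))
    (continuousOn_funPhi hml) ?_ ?_ <;> rw [interior_Icc] <;> intro z hz
  · exact (hasDerivAt_funPhi hml (Ioo_zero_subset_Ioo_neg mu hz)).hasDerivWithinAt
  · exact (arcsin_div_sub_arcsin_div_neg hml hz).le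

theorem concaveOn_funPhi {lam mu : ℝ} (hml : mu < lam) :
    ConcaveOn ℝ (Icc 0 mu) (funPhi lam mu) := by
  refine concaveOn_of_deriv2_nonpos (convex_Icc 0 mu) (continuousOn_funPhi hml) ?_ ?_ ?_ <;>
    rw [interior_Icc] <;> intro z hz <;> have hz := Ioo_zero_subset_Ioo_neg mu hz
  · exact (hasDerivAt_funPhi hml hz).differentiableAt.differentiableWithinAt
  · exact (hasDerivAt_deriv_funPhi hml hz).differentiableAt.differentiableWithinAt
  · exact (hasDerivAt_deriv_funPhi hml hz).deriv.trans_le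
      (one_div_sqrt_sub_one_div_sqrt_neg hml hz).le

theorem monotoneOn_funPhi_add {lam mu : ℝ} (hmu : 0 < mu) (hml : mu < lam) :
    MonotoneOn (fun z => funPhi lam mu z + (1 / π) * Real.arccos (mu / lam) * z)
      (Icc 0 mu) := by
  refine monotoneOn_of_hasDerivWithinAt_nonneg (convex_Icc 0 mu)
    (f' := fun z => (1 / π) * (Real.arcsin (z / lam) - Real.arcsin (z / mu)) +
      (1 / π) * Real.arccos (mu / lam) * 1)
    ((continuousOn_funPhi hml).add (by fun_prop)) ?_ ?_ <;> rw [interior_Icc] <;> intro z hz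
  · exact ((hasDerivAt_funPhi hml (Ioo_zero_subset_Ioo_neg mu hz)).add
      ((hasDerivAt_id z).const_mul _)).hasDerivWithinAt
  · have h := antitoneOn_arcsin_div_sub_arcsin_div hml (Ioo_subset_Icc_self hz)
      (right_mem_Icc.2 hmu.le) hz.2.le
    simp only [div_self hmu.ne', Real.arcsin_one] at h
    rw [Real.arccos]
    linarith

theorem LipschitzWithConstOn.of_antitoneOn_of_monotoneOn {c : ℝ} {g : ℝ → ℝ} {s : Set ℝ}
    (hg : AntitoneOn g s) (hc : MonotoneOn (fun z => g z + c * z) s) :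
    LipschitzWithConstOn c g s := by
  have key : ∀ z ∈ s, ∀ w ∈ s, z ≤ w → |g z - g w| ≤ c * |z - w| := by
    intro z hz w hw hzw
    have h := hc hz hw hzw
    simp only at h
    rw [abs_of_nonneg (sub_nonneg.2 (hg hz hw hzw)), abs_of_nonpos (sub_nonpos.2 hzw)]
    linarith
  intro z hz w hw
  rcases le_total z w with h | h
  · exact key z hz w hw h
  · rw [abs_sub_comm, abs_sub_comm z w]
    exact key w hw z hz h

theorem mul_lt_sin_of_lt_pi_div_four {t : ℝ} (h0 : 0 < t) (h1 : t < π / 4) :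
    2 * Real.sqrt 2 / π * t < Real.sin t := by
  have hpi := Real.pi_pos
  have hlt : 0 < 1 - t / (π / 4) := by
    rw [sub_pos, div_lt_one (by positivity)]
    exact h1
  have h0mem : (0 : ℝ) ∈ Icc 0 π := ⟨le_rfl, hpi.le⟩
  have hmem : π / 4 ∈ Icc 0 π := ⟨by positivity, by linarith⟩
  have hne : (0 : ℝ) ≠ π / 4 := by positivity
  have hpos : 0 < t / (π / 4) := by positivity
  have h := And.right strictConcaveOn_sin_Icc h0mem hmem hne hlt hpos (by ring)
  simp only [smul_eq_mul, mul_zero, zero_add, Real.sin_zero, Real.sin_pi_div_four] at h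
  rw [div_mul_cancel₀ t (by positivity)] at h
  refine lt_of_eq_of_lt ?_ h
  field_simp
  ring

theorem arccos_div_pi_lt {x : ℝ} (h0 : 0 < x) (h1 : x < 1) :
    (1 / π) * Real.arccos x < (1 / 2) * Real.sqrt (1 - x) := by
  have hpi := Real.pi_pos
  obtain ⟨t, ht⟩ : ∃ t, Real.arccos x = 2 * t := ⟨Real.arccos x / 2, by ring⟩
  have ht0 : 0 < t := by linarith [Real.arccos_pos.2 h1]
  have ht1 : t < π / 4 := by linarith [Real.arccos_lt_pi_div_two.2 h0]
  have hs := mul_lt_sin_of_lt_pi_div_four ht0 ht1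
  have hs0 : 0 < Real.sin t := Real.sin_pos_of_pos_of_lt_pi ht0 (by linarith)
  have hx : 1 - x = 2 * Real.sin t ^ 2 := by
    rw [← Real.cos_arccos (by linarith) h1.le, ht, Real.cos_two_mul, Real.cos_sq']
    ring
  have h2 : Real.sqrt 2 * Real.sqrt 2 = 2 := Real.mul_self_sqrt (by norm_num)
  rw [ht, hx, Real.sqrt_mul (by norm_num), Real.sqrt_sq hs0.le]
  calc 1 / π * (2 * t) = Real.sqrt 2 / 2 * (2 * Real.sqrt 2 / π * t) := by
        linear_combination (-t / π) * h2
    _ < Real.sqrt 2 / 2 * Real.sin t := by gcongr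
    _ = 1 / 2 * (Real.sqrt 2 * Real.sin t) := by ring

theorem funPhi_properties (lam mu : ℝ) (hmu : 0 < mu) (hml : mu < lam) :
    AntitoneOn (funPhi lam mu) (Set.Icc (0 : ℝ) mu) ∧
    ConcaveOn ℝ (Set.Icc (0 : ℝ) mu) (funPhi lam mu) ∧
    LipschitzWithConstOn ((1 / π) * Real.arccos (mu / lam)) (funPhi lam mu)
      (Set.Icc (0 : ℝ) mu) ∧
    (1 / π) * Real.arccos (mu / lam) < (1 / 2) * Real.sqrt (1 - mu / lam) ∧
    (1 / 2) * Real.sqrt (1 - mu / lam) < 1 / 2 ∧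
    (∀ z ∈ Set.Ioo (0 : ℝ) mu,
      (deriv (funPhi lam mu) z = (1 / π) * (Real.arcsin (z / lam) - Real.arcsin (z / mu)) ∧
        (1 / π) * (Real.arcsin (z / lam) - Real.arcsin (z / mu)) < 0) ∧
      (deriv (deriv (funPhi lam mu)) z =
          (1 / π) * (1 / Real.sqrt (lam ^ 2 - z ^ 2) - 1 / Real.sqrt (mu ^ 2 - z ^ 2)) ∧
        (1 / π) * (1 / Real.sqrt (lam ^ 2 - z ^ 2) - 1 / Real.sqrt (mu ^ 2 - z ^ 2)) < 0) ∧
      (deriv (deriv (deriv (funPhi lam mu))) z =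
          (z / π) * ((lam ^ 2 - z ^ 2) ^ (-(3 : ℝ) / 2) - (mu ^ 2 - z ^ 2) ^ (-(3 : ℝ) / 2)) ∧
        (z / π) * ((lam ^ 2 - z ^ 2) ^ (-(3 : ℝ) / 2) - (mu ^ 2 - z ^ 2) ^ (-(3 : ℝ) / 2)) < 0)) := by
  have hlam : 0 < lam := hmu.trans hml
  have hr0 : 0 < mu / lam := div_pos hmu hlam
  have hr1 : mu / lam < 1 := (div_lt_one hlam).2 hml
  refine ⟨antitoneOn_funPhi hml, concaveOn_funPhi hml,
    .of_antitoneOn_of_monotoneOn (antitoneOn_funPhi hml) (monotoneOn_funPhi_add hmu hml),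
    arccos_div_pi_lt hr0 hr1, ?_, fun z hz => ?_⟩
  · have h : Real.sqrt (1 - mu / lam) < 1 := by
      rw [Real.sqrt_lt' one_pos]
      linarith
    linarith
  · have hz' := Ioo_zero_subset_Ioo_neg mu hz
    exact ⟨⟨(hasDerivAt_funPhi hml hz').deriv, arcsin_div_sub_arcsin_div_neg hml hz⟩,
      ⟨(hasDerivAt_deriv_funPhi hml hz').deriv, one_div_sqrt_sub_one_div_sqrt_neg hml hz'⟩,
      ⟨(hasDerivAt_deriv_deriv_funPhi hml hz').deriv, rpow_sub_rpow_neg hml hz⟩⟩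
end

section
/- Let λ > μ > 0. Then for all z ∈ (0, μ): Φ_{λ,μ}(0) − Φ_{λ,μ}(z) > (λ − μ)z²/(2πλμ). -/
open Real Set

theorem sub_lt_arcsin_sub_arcsin {a b : ℝ} (ha : -1 ≤ a) (hab : a < b) (hb : b ≤ 1) :
    b - a < arcsin b - arcsin a := by
  have hlt : arcsin a < arcsin b := arcsin_lt_arcsin ha hab hb
  have hsin : sin (arcsin b) - sin (arcsin a) = b - a := by
    rw [sin_arcsin (by linarith) hb, sin_arcsin ha (by linarith)]
  rw [sin_sub_sin] at hsin
  have hpos : 0 < (arcsin b - arcsin a) / 2 := by linarith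
  have hle : (arcsin b - arcsin a) / 2 ≤ π := by
    linarith [arcsin_le_pi_div_two b, neg_pi_div_two_le_arcsin a, pi_pos]
  have h0 : 0 ≤ sin ((arcsin b - arcsin a) / 2) := sin_nonneg_of_nonneg_of_le_pi hpos.le hle
  have h1 := sin_lt hpos
  nlinarith [mul_le_mul_of_nonneg_left (cos_le_one ((arcsin b + arcsin a) / 2)) h0]

theorem hasDerivAt_sqrt_sub_mul_arccos {r z : ℝ} (hz : 0 < z) (hzr : z < r) :
    HasDerivAt (fun x => √(r ^ 2 - x ^ 2) - x * arccos (x / r)) (-arccos (z / r)) z := by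
  have hr : 0 < r := hz.trans hzr
  have hpos : 0 < r ^ 2 - z ^ 2 := by nlinarith
  have hne : √(r ^ 2 - z ^ 2) ≠ 0 := (sqrt_pos.2 hpos).ne'
  have hlt : z / r < 1 := (div_lt_one hr).2 hzr
  have hgt : 0 < z / r := div_pos hz hr
  have hsqrt : √(1 - (z / r) ^ 2) = √(r ^ 2 - z ^ 2) / r := by
    rw [show 1 - (z / r) ^ 2 = (r ^ 2 - z ^ 2) / r ^ 2 by field_simp, sqrt_div' _ (sq_nonneg r),
      sqrt_sq hr.le]
  have h1 := (((hasDerivAt_id z).pow 2).const_sub (r ^ 2)).sqrt hpos.ne'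
  have h2 := (hasDerivAt_arccos (by linarith) hlt.ne).comp z ((hasDerivAt_id z).div_const r)
  refine (h1.sub ((hasDerivAt_id z).mul h2)).congr_deriv ?_
  simp only [id, Function.comp_apply, Pi.pow_apply, hsqrt]
  field_simp
  ring

theorem funPhi_diff_lower_bound (lam mu : ℝ) (hmu : 0 < mu) (hml : mu < lam) :
    ∀ z ∈ Set.Ioo (0 : ℝ) mu,
      (lam - mu) * z ^ 2 / (2 * π * lam * mu) < funPhi lam mu 0 - funPhi lam mu z := by
  rintro z ⟨hz, hzm⟩
  have hlam : 0 < lam := hmu.trans hml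
  let g : ℝ → ℝ → ℝ := fun r x => √(r ^ 2 - x ^ 2) - x * arccos (x / r)
  let h : ℝ → ℝ := fun x => g mu x - g lam x - (lam - mu) / (2 * lam * mu) * x ^ 2
  have hmono : StrictMonoOn h (Icc 0 mu) := by
    refine strictMonoOn_of_deriv_pos (convex_Icc 0 mu) ?_ fun x hx => ?_
    · simp only [h, g]
      fun_prop
    · rw [interior_Icc] at hx
      have hd := ((hasDerivAt_sqrt_sub_mul_arccos hx.1 hx.2).sub
        (hasDerivAt_sqrt_sub_mul_arccos hx.1 (hx.2.trans hml))).sub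
        (((hasDerivAt_id x).pow 2).const_mul ((lam - mu) / (2 * lam * mu)))
      have hd' : HasDerivAt h _ x := hd
      rw [hd'.deriv]
      have hlt := sub_lt_arcsin_sub_arcsin (a := x / lam) (b := x / mu)
        (by linarith [div_pos hx.1 hlam]) (div_lt_div_of_pos_left hx.1 hmu hml)
        ((div_le_one hmu).2 hx.2.le)
      have heq : (lam - mu) / (2 * lam * mu) * (2 * x) = x / mu - x / lam := by
        field_simp
      simp [arccos]
      linarith
  have hlt := hmono ⟨le_rfl, hmu.le⟩ ⟨hz.le, hzm.le⟩ hz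
  simp only [h, g] at hlt
  have hdiv : (lam - mu) * z ^ 2 / (2 * π * lam * mu)
      = (lam - mu) / (2 * lam * mu) * z ^ 2 / π := by
    field_simp
  rw [hdiv]
  simp only [funPhi, funG, if_pos hlam.le, if_pos hmu.le, if_pos hzm.le,
    if_pos (hzm.trans hml).le, ← sub_div]
  exact div_lt_div_of_pos_right (by linarith) pi_pos
end
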